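/- arXiv:2009.14518 — 5 statements merged into one kernel-verified Lean document; each statement's English description precedes it below -/
import Mathlib

section
/- The linear projection (v,w) ↦ v restricts to a linear isomorphism from rad Ω onto the subspace K := {v ∈ ξ : β(v,u) = 0 for all u ∈ ξ}. Consequently: dim rad Ω equals the dimension of the kernel of the restriction β|_ξ; dim rad Ω ≤ dim ξ; and dim rad Ω = dim ξ if and only if β vanishes identically on ξ × ξ. -/
/-- A vector `(v, w)` lies in the radical of the twisted form
`∑ᵢ (wᵢ αᵢ(v') − w'ᵢ αᵢ(v)) + B(v, v')` iff every `αᵢ` vanishes at `v` and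
`∑ᵢ wᵢ αᵢ = -B(v, ·)`. -/
theorem mem_ker_twisted_form_iff {R V ι : Type*} [CommRing R] [AddCommGroup V] [Module R V]
    [Fintype ι] (α : ι → V →ₗ[R] R) (B : V →ₗ[R] V →ₗ[R] R)
    (Ω : (V × (ι → R)) →ₗ[R] (V × (ι → R)) →ₗ[R] R)
    (hΩ : ∀ z z', Ω z z' = ∑ i, (z.2 i * α i z'.1 - z'.2 i * α i z.1) + B z.1 z'.1)
    (z : V × (ι → R)) :
    z ∈ LinearMap.ker Ω ↔ (∀ i, α i z.1 = 0) ∧ ∑ i, z.2 i • α i = -B z.1 := by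
  classical
  rw [LinearMap.mem_ker]
  constructor
  · intro hz
    constructor
    · intro i
      have h := hΩ z (0, Pi.single i 1)
      simpa [hz, Pi.single_apply] using h
    · ext v
      have h := hΩ z (v, 0)
      simp only [hz, LinearMap.zero_apply, Pi.zero_apply, zero_mul, sub_zero] at h
      simpa using eq_neg_of_add_eq_zero_left h.symm
  · rintro ⟨hv, hw⟩
    refine LinearMap.ext fun z' => ?_
    have h := LinearMap.congr_fun hw z'.1
    simp only [LinearMap.sum_apply, LinearMap.smul_apply, smul_eq_mul, LinearMap.neg_apply] at h
    simp [hΩ, hv, h]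

/-- With `Ω` the bilinear form `Ω ((v,w),(v',w')) = ∑ᵢ (wᵢ αᵢ(v') − w'ᵢ αᵢ(v) + aᵢ βᵢ(v,v'))`
on `ℝ^m × ℝ^k` (`α` linearly independent, `β i` alternating), `ξ = ⋂ᵢ ker αᵢ`,
`β* = ∑ᵢ aᵢ βᵢ`, and `K = {v ∈ ξ : β*(v,u) = 0 ∀ u ∈ ξ}`:
the projection `(v,w) ↦ v` restricts to a linear isomorphism from `rad Ω = ker Ω` onto `K`;
consequently `dim rad Ω = dim K` (the kernel of `β*|ξ`), `dim rad Ω ≤ dim ξ`, and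
`dim rad Ω = dim ξ` iff `β*` vanishes identically on `ξ × ξ`. -/
theorem radical_iso_kernel_of_restricted_form
    (m k : ℕ) (hm : 1 ≤ m) (hk : 1 ≤ k)
    (α : Fin k → ((Fin m → ℝ) →ₗ[ℝ] ℝ)) (hα : LinearIndependent ℝ α)
    (β : Fin k → ((Fin m → ℝ) →ₗ[ℝ] (Fin m → ℝ) →ₗ[ℝ] ℝ))
    (hβ : ∀ i v, β i v v = 0)
    (a : Fin k → ℝ)
    (Ω : ((Fin m → ℝ) × (Fin k → ℝ)) →ₗ[ℝ] ((Fin m → ℝ) × (Fin k → ℝ)) →ₗ[ℝ] ℝ)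
    (hΩ : ∀ z z', Ω z z' =
      ∑ i, (z.2 i * α i z'.1 - z'.2 i * α i z.1 + a i * β i z.1 z'.1))
    (ξ : Submodule ℝ (Fin m → ℝ)) (hξ : ξ = ⨅ i, LinearMap.ker (α i))
    (βa : (Fin m → ℝ) →ₗ[ℝ] (Fin m → ℝ) →ₗ[ℝ] ℝ) (hβa : βa = ∑ i, a i • β i)
    (K : Submodule ℝ (Fin m → ℝ))
    (hK : K = ξ ⊓ ⨅ u : ↥ξ, LinearMap.ker (βa.flip (u : Fin m → ℝ))) :
    Submodule.map (LinearMap.fst ℝ (Fin m → ℝ) (Fin k → ℝ)) (LinearMap.ker Ω) = K ∧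
    (∀ z ∈ LinearMap.ker Ω, ∀ z' ∈ LinearMap.ker Ω, z.1 = z'.1 → z = z') ∧
    Module.finrank ℝ ↥(LinearMap.ker Ω) = Module.finrank ℝ ↥K ∧
    Module.finrank ℝ ↥(LinearMap.ker Ω) ≤ Module.finrank ℝ ↥ξ ∧
    (Module.finrank ℝ ↥(LinearMap.ker Ω) = Module.finrank ℝ ↥ξ ↔
      ∀ v ∈ ξ, ∀ u ∈ ξ, βa v u = 0) := by
  have hΩ' : ∀ z z', Ω z z' =
      ∑ i, (z.2 i * α i z'.1 - z'.2 i * α i z.1) + βa z.1 z'.1 := by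
    intro z z'
    simp [hΩ, hβa, Finset.sum_add_distrib]
  have hker := mem_ker_twisted_form_iff α βa Ω hΩ'
  have memξ : ∀ v, v ∈ ξ ↔ ∀ i, α i v = 0 := by simp [hξ]
  have memK : ∀ v, v ∈ K ↔ v ∈ ξ ∧ ∀ u ∈ ξ, βa v u = 0 := by simp [hK]
  have hmap : Submodule.map (LinearMap.fst ℝ (Fin m → ℝ) (Fin k → ℝ)) (LinearMap.ker Ω) = K := by
    ext v
    rw [memK, Submodule.mem_map]
    constructor
    · rintro ⟨z, hz, rfl⟩
      obtain ⟨hv, hw⟩ := (hker z).1 hz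
      refine ⟨(memξ _).2 hv, fun u hu => ?_⟩
      have h := LinearMap.congr_fun hw u
      simpa [(memξ u).1 hu] using h
    · rintro ⟨hv, hβv⟩
      have hspan : -βa v ∈ Submodule.span ℝ (Set.range α) :=
        mem_span_of_iInf_ker_le_ker fun u hu => by
          simpa using hβv u (hξ ▸ hu)
      obtain ⟨w, hw⟩ := (Submodule.mem_span_range_iff_exists_fun ℝ).1 hspan
      exact ⟨(v, w), (hker _).2 ⟨(memξ v).1 hv, hw⟩, rfl⟩
  have hinj : ∀ z ∈ LinearMap.ker Ω, ∀ z' ∈ LinearMap.ker Ω, z.1 = z'.1 → z = z' := by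
    intro z hz z' hz' h
    refine Prod.ext h ?_
    have hw := ((hker z).1 hz).2
    rw [h, ← ((hker z').1 hz').2] at hw
    exact funext (Fintype.linearIndependent_iffₛ.1 hα _ _ hw)
  have hrank : Module.finrank ℝ ↥(LinearMap.ker Ω) = Module.finrank ℝ ↥K := by
    have hinj' : Function.Injective
        ((LinearMap.fst ℝ (Fin m → ℝ) (Fin k → ℝ)).domRestrict (LinearMap.ker Ω)) :=
      fun z z' h => Subtype.ext (hinj z z.2 z' z'.2 h)
    rw [← hmap, ← LinearMap.range_domRestrict, LinearMap.finrank_range_of_inj hinj']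
  have hKξ : K ≤ ξ := fun v hv => ((memK v).1 hv).1
  refine ⟨hmap, hinj, hrank, hrank ▸ Submodule.finrank_mono hKξ, ?_⟩
  rw [hrank]
  constructor
  · intro h v hv
    exact ((memK v).1 ((Submodule.eq_of_le_of_finrank_eq hKξ h).symm ▸ hv)).2
  · intro h
    rw [le_antisymm hKξ fun v hv => (memK v).2 ⟨hv, h v hv⟩]
end

section
/- Fix an integer i_n with 1 ≤ i_n ≤ k and suppose a_i = 0 for all i > i_n. Let Ω_n be the alternating bilinear form on ℝ^m × ℝ^{i_n} defined by the same formula using only α_1, …, α_{i_n}, β_1, …, β_{i_n} and (a_1, …, a_{i_n}), and let rad Ω_n be its radical. Then for every (v,w) ∈ ℝ^m × ℝ^k with w_i = 0 for all i > i_n, the following are equivalent: (v,w) ∈ rad Ω; and [ (v,(w_1, …, w_{i_n})) ∈ rad Ω_n and α_i(v) = 0 for all i = 1, …, k ]. -/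
/-- A sum over `Fin k` of a function vanishing from index `n` on is the sum over `Fin n`. -/
theorem Fin.sum_castLE_of_eq_zero {M : Type*} [AddCommMonoid M] {n k : ℕ} (h : n ≤ k)
    (f : Fin k → M) (hf : ∀ i : Fin k, n ≤ (i : ℕ) → f i = 0) :
    ∑ j : Fin n, f (Fin.castLE h j) = ∑ i, f i := by
  refine Fintype.sum_of_injective (Fin.castLE h) (Fin.castLE_injective h) _ _
    (fun i hi => hf i ?_) fun _ => rfl
  by_contra! hlt
  exact hi ⟨⟨i, hlt⟩, rfl⟩

/-- With `Ω ((v,w),(v',w')) = ∑_{i<k} (wᵢ αᵢ(v') − w'ᵢ αᵢ(v) + aᵢ βᵢ(v,v'))` on `ℝ^m × ℝ^k`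
(`α` linearly independent, `β i` alternating), fix `1 ≤ iN ≤ k` and suppose `a i = 0` for all
(0-indexed) `i ≥ iN`.  Let `Ωn` be the analogous form on `ℝ^m × ℝ^{iN}` built from the first
`iN` of the `α, β, a`.  Then for every `(v,w)` with `w i = 0` for all `i ≥ iN`:
`(v,w) ∈ rad Ω` iff `(v, w|_{iN}) ∈ rad Ωn` and `α i v = 0` for all `i`. -/
theorem radical_of_truncated_form
    (m k : ℕ) (hm : 1 ≤ m) (hk : 1 ≤ k)
    (α : Fin k → ((Fin m → ℝ) →ₗ[ℝ] ℝ)) (hα : LinearIndependent ℝ α)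
    (β : Fin k → ((Fin m → ℝ) →ₗ[ℝ] (Fin m → ℝ) →ₗ[ℝ] ℝ))
    (hβ : ∀ i v, β i v v = 0)
    (a : Fin k → ℝ)
    (iN : ℕ) (hiN1 : 1 ≤ iN) (hiNk : iN ≤ k)
    (ha : ∀ i : Fin k, iN ≤ (i : ℕ) → a i = 0)
    (Ω : ((Fin m → ℝ) × (Fin k → ℝ)) → ((Fin m → ℝ) × (Fin k → ℝ)) → ℝ)
    (hΩ : ∀ z z', Ω z z' =
      ∑ i, (z.2 i * α i z'.1 - z'.2 i * α i z.1 + a i * β i z.1 z'.1))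
    (Ωn : ((Fin m → ℝ) × (Fin iN → ℝ)) → ((Fin m → ℝ) × (Fin iN → ℝ)) → ℝ)
    (hΩn : ∀ z z', Ωn z z' =
      ∑ j : Fin iN, (z.2 j * α (Fin.castLE hiNk j) z'.1
        - z'.2 j * α (Fin.castLE hiNk j) z.1
        + a (Fin.castLE hiNk j) * β (Fin.castLE hiNk j) z.1 z'.1))
    (v : Fin m → ℝ) (w : Fin k → ℝ)
    (hw : ∀ i : Fin k, iN ≤ (i : ℕ) → w i = 0) :
    (∀ z', Ω (v, w) z' = 0) ↔
      ((∀ z', Ωn (v, fun j => w (Fin.castLE hiNk j)) z' = 0) ∧ ∀ i, α i v = 0) := by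
  have hsum (v' : Fin m → ℝ) :=
    Fin.sum_castLE_of_eq_zero hiNk (fun i => w i * α i v' + a i * β i v v')
      fun i hi => by simp [hw i hi, ha i hi]
  constructor
  · intro h
    have hv (i : Fin k) : α i v = 0 := by
      simpa [hΩ, Pi.single_apply] using h (0, Pi.single i 1)
    refine ⟨fun z' => ?_, hv⟩
    have h0 := h (z'.1, 0)
    simp only [hΩ, hv, mul_zero, sub_zero] at h0
    simpa only [hΩn, hv, mul_zero, sub_zero] using (hsum z'.1).trans h0
  · rintro ⟨h, hv⟩ z'
    have h0 := h (z'.1, 0)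
    simp only [hΩn, hv, mul_zero, sub_zero] at h0
    simpa only [hΩ, hv, mul_zero, sub_zero] using (hsum z'.1).symm.trans h0
end

section
/- Suppose f : ℝ^l × ℝ^p → L(ℝ^l, ℝ^p) is smooth (C^∞). Then for every x₀ ∈ ℝ^l, y₀ ∈ ℝ^p, every integer r ≥ 1 and every tuple (a_1, …, a_r) ∈ (ℝ^l)^r there exists a unique tuple (b_1, …, b_r) ∈ (ℝ^p)^r with the following property: setting x(t) := x₀ + Σ_{j=1}^r a_j t^j and y(t) := y₀ + Σ_{j=1}^r b_j t^j, the map g(t) := y′(t) − f(x(t), y(t))(x′(t)) satisfies g^{(j)}(0) = 0 for all 0 ≤ j ≤ r−1 (i.e. the curve (x, y) is horizontal to order r at t = 0). Moreover, for fixed (x₀, y₀) the map (a_1, …, a_r) ↦ (b_1, …, b_r) is a polynomial map, each coordinate of b_j being given by a real polynomial in the coordinates of a_1, …, a_j. -/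
/-- The polynomial curve `t ↦ c₀ + ∑_{j=1}^r c_j t^j` in `ℝ^d`
(indexing: `c j` is the coefficient of `t^(j+1)` for `j : Fin r`). -/
noncomputable def polyCurve {d : ℕ} (c₀ : Fin d → ℝ) {r : ℕ} (c : Fin r → (Fin d → ℝ)) :
    ℝ → (Fin d → ℝ) :=
  fun t => c₀ + ∑ j : Fin r, t ^ ((j : ℕ) + 1) • c j

/-- `IsJetLift f x₀ y₀ r a b` : setting `x t = x₀ + ∑ a_j t^j` and `y t = y₀ + ∑ b_j t^j`,
the defect `g t = y′ t − f (x t, y t) (x′ t)` vanishes to order `r` at `t = 0`, i.e.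
`g⁽ʲ⁾(0) = 0` for all `0 ≤ j ≤ r − 1` (the curve `(x, y)` is horizontal to order `r`). -/
def IsJetLift {l p : ℕ}
    (f : (Fin l → ℝ) × (Fin p → ℝ) → ((Fin l → ℝ) →L[ℝ] (Fin p → ℝ)))
    (x₀ : Fin l → ℝ) (y₀ : Fin p → ℝ) (r : ℕ)
    (a : Fin r → (Fin l → ℝ)) (b : Fin r → (Fin p → ℝ)) : Prop :=
  ∀ j < r,
    iteratedDeriv j
      (fun t : ℝ =>
        deriv (polyCurve y₀ b) t
          - f (polyCurve x₀ a t, polyCurve y₀ b t) (deriv (polyCurve x₀ a) t)) 0 = 0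

open scoped Nat ContDiff

theorem iteratedDeriv_apply_pi {ι : Type*} [Fintype ι] {g : ℝ → ι → ℝ} {n : ℕ} {t : ℝ}
    (hg : ContDiffAt ℝ n g t) (i : ι) :
    iteratedDeriv n g t i = iteratedDeriv n (fun s => g s i) t := by
  have h := (ContinuousLinearMap.proj i : (ι → ℝ) →L[ℝ] ℝ).iteratedFDeriv_comp_left hg le_rfl
  have h' := congrArg (fun m => m fun _ => (1 : ℝ)) h
  simpa [iteratedDeriv_eq_iteratedFDeriv, Function.comp_def] using h'.symm

/-- The Taylor coefficients of a product lie in every algebra of functions of the parameter that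
contains the Taylor coefficients of the factors. -/
theorem iteratedDeriv_mul_mem {X : Type*} (A : Subalgebra ℝ (X → ℝ)) {u v : X → ℝ → ℝ} {n : ℕ}
    (hu : ∀ x, ContDiff ℝ ∞ (u x)) (hv : ∀ x, ContDiff ℝ ∞ (v x))
    (hu' : ∀ k ≤ n, (fun x => iteratedDeriv k (u x) 0) ∈ A)
    (hv' : ∀ k ≤ n, (fun x => iteratedDeriv k (v x) 0) ∈ A) :
    (fun x => iteratedDeriv n (fun t => u x t * v x t) 0) ∈ A := by
  have h : (fun x => iteratedDeriv n (fun t => u x t * v x t) 0) =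
      ∑ k ∈ Finset.range (n + 1), ((n.choose k : ℕ) : X → ℝ) *
        (fun x => iteratedDeriv k (u x) 0) * (fun x => iteratedDeriv (n - k) (v x) 0) := by
    ext x
    rw [iteratedDeriv_fun_mul ((hu x).contDiffAt.of_le (by exact_mod_cast le_top))
      ((hv x).contDiffAt.of_le (by exact_mod_cast le_top))]
    simp [Finset.sum_apply]
  rw [h]
  refine A.sum_mem fun k hk => A.mul_mem (A.mul_mem (A.natCast_mem _) (hu' k ?_)) (hv' _ ?_)
  · exact Nat.lt_succ_iff.mp (Finset.mem_range.mp hk)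
  · exact Nat.sub_le _ _

/-- Let `γ x` be a family of curves through a common point `z`, with coordinates `u x i` along
vectors `e i`. The `n`-th derivative at `0` of a smooth function along `γ x` lies in every algebra
of functions of `x` that contains the derivatives of the coordinates of orders `1, …, n`. -/
theorem iteratedDeriv_comp_mem {X ι E : Type*} [Fintype ι] [NormedAddCommGroup E]
    [NormedSpace ℝ E] (A : Subalgebra ℝ (X → ℝ)) (z : E) (e : ι → E) (u : X → ι → ℝ → ℝ)
    (γ : X → ℝ → E) (hγ : ∀ x t, γ x t = ∑ i, u x i t • e i) (hz : ∀ x, γ x 0 = z)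
    (hu : ∀ x i, ContDiff ℝ ∞ (u x i)) (n : ℕ)
    (huA : ∀ k < n, ∀ i, (fun x => iteratedDeriv (k + 1) (u x i) 0) ∈ A)
    (F : E → ℝ) (hF : ContDiff ℝ ∞ F) :
    (fun x => iteratedDeriv n (fun t => F (γ x t)) 0) ∈ A := by
  have hγs : ∀ x, ContDiff ℝ ∞ (γ x) := fun x => by
    rw [funext (hγ x)]
    exact ContDiff.sum fun i _ => (hu x i).smul contDiff_const
  induction n using Nat.strong_induction_on generalizing F with
  | _ n ih =>
    cases n with
    | zero =>
      simp only [iteratedDeriv_zero, hz]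
      exact A.algebraMap_mem (F z)
    | succ n =>
      have hF' : ∀ i, ContDiff ℝ ∞ (fun w => fderiv ℝ F w (e i)) := fun i =>
        (hF.fderiv_right (m := ∞) (by simp)).clm_apply contDiff_const
      have hu' : ∀ x i, ContDiff ℝ ∞ (deriv (u x i)) := fun x i => by
        simpa using (contDiff_infty_iff_deriv.mp (hu x i)).2
      have hderiv : ∀ x, deriv (fun t => F (γ x t)) =
          fun t => ∑ i, fderiv ℝ F (γ x t) (e i) * deriv (u x i) t := fun x => by
        ext t
        have h1 : HasDerivAt (γ x) (∑ i, deriv (u x i) t • e i) t := by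
          rw [funext (hγ x)]
          exact HasDerivAt.fun_sum fun i _ =>
            (((hu x i).differentiable (by simp)) t).hasDerivAt.smul_const (e i)
        have h2 := ((hF.differentiable (by simp)) (γ x t)).hasFDerivAt.comp_hasDerivAt t h1
        simpa [Function.comp_def, mul_comm] using h2.deriv
      have hsum : (fun x => iteratedDeriv (n + 1) (fun t => F (γ x t)) 0) =
          ∑ i, fun x => iteratedDeriv n
            (fun t => fderiv ℝ F (γ x t) (e i) * deriv (u x i) t) 0 := by
        ext x
        rw [iteratedDeriv_succ', hderiv, iteratedDeriv_fun_sum, Finset.sum_apply]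
        exact fun i _ => (((hF' i).comp (hγs x)).mul (hu' x i)).contDiffAt.of_le
          (by exact_mod_cast le_top)
      rw [hsum]
      refine A.sum_mem fun i _ => iteratedDeriv_mul_mem A (fun x => (hF' i).comp (hγs x))
        (fun x => hu' x i) (fun k hk => ?_) (fun k hk => ?_)
      · exact ih k (Nat.lt_succ_iff.mpr hk) (fun m hm => huA m (by omega)) _ (hF' i)
      · simpa only [iteratedDeriv_succ'] using huA k (Nat.lt_succ_iff.mpr hk) i

theorem polyCurve_apply {d : ℕ} (c₀ : Fin d → ℝ) {r : ℕ} (c : Fin r → (Fin d → ℝ)) (t : ℝ)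
    (i : Fin d) : polyCurve c₀ c t i = c₀ i + ∑ j : Fin r, t ^ ((j : ℕ) + 1) * c j i := by
  simp [polyCurve, Finset.sum_apply]

theorem polyCurve_zero {d : ℕ} (c₀ : Fin d → ℝ) {r : ℕ} (c : Fin r → (Fin d → ℝ)) :
    polyCurve c₀ c 0 = c₀ := by
  simp [polyCurve]

theorem contDiff_polyCurve {d : ℕ} (c₀ : Fin d → ℝ) {r : ℕ} (c : Fin r → (Fin d → ℝ)) :
    ContDiff ℝ ∞ (polyCurve c₀ c) := by
  unfold polyCurve
  fun_prop

theorem contDiff_deriv_polyCurve {d : ℕ} (c₀ : Fin d → ℝ) {r : ℕ} (c : Fin r → (Fin d → ℝ)) :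
    ContDiff ℝ ∞ (deriv (polyCurve c₀ c)) :=
  (contDiff_infty_iff_deriv.mp (contDiff_polyCurve c₀ c)).2

theorem contDiff_polyCurve_apply {d : ℕ} (c₀ : Fin d → ℝ) {r : ℕ} (c : Fin r → (Fin d → ℝ))
    (i : Fin d) : ContDiff ℝ ∞ (fun t => polyCurve c₀ c t i) :=
  contDiff_pi.mp (contDiff_polyCurve c₀ c) i

theorem deriv_polyCurve_apply {d : ℕ} (c₀ : Fin d → ℝ) {r : ℕ} (c : Fin r → (Fin d → ℝ)) (t : ℝ)
    (i : Fin d) : deriv (polyCurve c₀ c) t i = deriv (fun s => polyCurve c₀ c s i) t :=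
  (((hasDerivAt_pi.mp (((contDiff_polyCurve c₀ c).differentiable (by simp)) t).hasDerivAt)
    i).deriv).symm

theorem iteratedDeriv_succ_polyCurve_apply {d : ℕ} (c₀ : Fin d → ℝ) {r : ℕ}
    (c : Fin r → (Fin d → ℝ)) (k : ℕ) (i : Fin d) :
    iteratedDeriv (k + 1) (fun t => polyCurve c₀ c t i) 0 =
      if h : k < r then ((k + 1)! : ℝ) * c ⟨k, h⟩ i else 0 := by
  simp only [polyCurve_apply]
  rw [iteratedDeriv_const_add k.succ_pos, iteratedDeriv_fun_sum (fun j _ => by fun_prop)]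
  simp only [iteratedDeriv_mul_const_field, iteratedDeriv_fun_pow_zero]
  split_ifs with h
  · rw [Finset.sum_eq_single ⟨k, h⟩ _ (by simp)]
    · simp
    · intro j _ hj
      rw [if_neg fun hk => hj (Fin.ext (Nat.succ_injective hk.symm)), Nat.cast_zero, zero_mul]
  · exact Finset.sum_eq_zero fun j _ => by
      rw [if_neg (by have := j.isLt; omega), Nat.cast_zero, zero_mul]

/-- Derivatives of a polynomial curve at `0` lie in every algebra containing its coefficients. -/
theorem iteratedDeriv_succ_polyCurve_apply_mem {X : Type*} (A : Subalgebra ℝ (X → ℝ)) {d r : ℕ}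
    (c₀ : Fin d → ℝ) (c : X → Fin r → (Fin d → ℝ)) (k : ℕ) (i : Fin d)
    (hc : ∀ j : Fin r, (j : ℕ) = k → (fun x => c x j i) ∈ A) :
    (fun x => iteratedDeriv (k + 1) (fun t => polyCurve c₀ (c x) t i) 0) ∈ A := by
  simp only [iteratedDeriv_succ_polyCurve_apply]
  by_cases h : k < r
  · simp only [h, dif_pos]
    exact A.mul_mem (A.algebraMap_mem ((k + 1)! : ℝ)) (hc ⟨k, h⟩ rfl)
  · simp only [h, dif_neg, not_false_eq_true]
    exact A.zero_mem

section JetLift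

variable {l p : ℕ} {f : (Fin l → ℝ) × (Fin p → ℝ) → ((Fin l → ℝ) →L[ℝ] (Fin p → ℝ))}
  {x₀ : Fin l → ℝ} {y₀ : Fin p → ℝ} {r : ℕ}

/-- The velocity prescribed by the lifting equation along the curve with coefficients `(a, b)`. -/
noncomputable def liftVelocity
    (f : (Fin l → ℝ) × (Fin p → ℝ) → ((Fin l → ℝ) →L[ℝ] (Fin p → ℝ)))
    (x₀ : Fin l → ℝ) (y₀ : Fin p → ℝ) (a : Fin r → (Fin l → ℝ)) (b : Fin r → (Fin p → ℝ)) (t : ℝ) :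
    Fin p → ℝ :=
  f (polyCurve x₀ a t, polyCurve y₀ b t) (deriv (polyCurve x₀ a) t)

theorem contDiff_liftVelocity (hf : ContDiff ℝ ∞ f) (a : Fin r → (Fin l → ℝ))
    (b : Fin r → (Fin p → ℝ)) : ContDiff ℝ ∞ (liftVelocity f x₀ y₀ a b) :=
  (hf.comp ((contDiff_polyCurve x₀ a).prodMk (contDiff_polyCurve y₀ b))).clm_apply
    (contDiff_deriv_polyCurve x₀ a)

theorem isJetLift_iff (hf : ContDiff ℝ ∞ f) (a : Fin r → (Fin l → ℝ))
    (b : Fin r → (Fin p → ℝ)) :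
    IsJetLift f x₀ y₀ r a b ↔ ∀ (j : Fin r) (c : Fin p),
      (((j : ℕ) + 1)! : ℝ) * b j c =
        iteratedDeriv j (fun t => liftVelocity f x₀ y₀ a b t c) 0 := by
  have key : ∀ (j : Fin r) (c : Fin p), iteratedDeriv j (fun t : ℝ =>
        deriv (polyCurve y₀ b) t
          - f (polyCurve x₀ a t, polyCurve y₀ b t) (deriv (polyCurve x₀ a) t)) 0 c =
      (((j : ℕ) + 1)! : ℝ) * b j c -
        iteratedDeriv j (fun t => liftVelocity f x₀ y₀ a b t c) 0 := by
    intro j c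
    have hj : ((j : ℕ) : WithTop ℕ∞) ≤ ∞ := by exact_mod_cast le_top
    have hy : ContDiff ℝ ∞ (deriv (polyCurve y₀ b)) := contDiff_deriv_polyCurve y₀ b
    have hv := contDiff_liftVelocity (x₀ := x₀) (y₀ := y₀) hf a b
    have hyc : ContDiff ℝ ∞ (fun t => deriv (polyCurve y₀ b) t c) := contDiff_pi.mp hy c
    have hvc : ContDiff ℝ ∞ (fun t => liftVelocity f x₀ y₀ a b t c) := contDiff_pi.mp hv c
    have hd := iteratedDeriv_succ_polyCurve_apply y₀ b j c
    rw [dif_pos j.isLt, iteratedDeriv_succ'] at hd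
    refine (iteratedDeriv_apply_pi ((hy.sub hv).contDiffAt.of_le hj) c).trans ?_
    simp only [Pi.sub_apply]
    rw [← hd, ← funext fun t => deriv_polyCurve_apply y₀ b t c]
    exact iteratedDeriv_fun_sub (hyc.contDiffAt.of_le hj) (hvc.contDiffAt.of_le hj)
  refine ⟨fun h j c => ?_, fun h j hj => funext fun c => ?_⟩
  · rw [← sub_eq_zero, ← key, h j j.isLt, Pi.zero_apply]
  · rw [key ⟨j, hj⟩ c, h ⟨j, hj⟩ c, sub_self, Pi.zero_apply]

/-- The `n`-th derivative at `0` of the prescribed velocity lies in every algebra of functions of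
the parameter that contains the coefficients of `x` up to order `n + 1` and those of `y` up to
order `n`. -/
theorem iteratedDeriv_liftVelocity_mem {X : Type*} (A : Subalgebra ℝ (X → ℝ))
    (hf : ContDiff ℝ ∞ f) (a : X → Fin r → (Fin l → ℝ)) (b : X → Fin r → (Fin p → ℝ)) (n : ℕ)
    (ha : ∀ (j : Fin r) (i : Fin l), (j : ℕ) ≤ n → (fun x => a x j i) ∈ A)
    (hb : ∀ (j : Fin r) (i : Fin p), (j : ℕ) < n → (fun x => b x j i) ∈ A) (c : Fin p) :
    (fun x => iteratedDeriv n (fun t => liftVelocity f x₀ y₀ (a x) (b x) t c) 0) ∈ A := by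
  set γ : X → ℝ → (Fin l → ℝ) × (Fin p → ℝ) :=
    fun x t => (polyCurve x₀ (a x) t, polyCurve y₀ (b x) t) with hγdef
  have hγs : ∀ x, ContDiff ℝ ∞ (γ x) := fun x =>
    (contDiff_polyCurve x₀ (a x)).prodMk (contDiff_polyCurve y₀ (b x))
  let F : Fin l → (Fin l → ℝ) × (Fin p → ℝ) → ℝ := fun i z => f z (Pi.single i 1) c
  have hF : ∀ i, ContDiff ℝ ∞ (F i) := fun i =>
    contDiff_pi.mp (hf.clm_apply contDiff_const) c
  have hx' : ∀ x i, ContDiff ℝ ∞ (deriv fun t => polyCurve x₀ (a x) t i) := fun x i =>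
    (contDiff_infty_iff_deriv.mp (contDiff_polyCurve_apply x₀ (a x) i)).2
  have hsum : (fun x => iteratedDeriv n (fun t => liftVelocity f x₀ y₀ (a x) (b x) t c) 0) =
      ∑ i, fun x => iteratedDeriv n
        (fun t => F i (γ x t) * deriv (fun s => polyCurve x₀ (a x) s i) t) 0 := by
    ext x
    have hv : (fun t => liftVelocity f x₀ y₀ (a x) (b x) t c) =
        fun t => ∑ i, F i (γ x t) * deriv (fun s => polyCurve x₀ (a x) s i) t := by
      ext t
      simp only [liftVelocity, F, hγdef, ← deriv_polyCurve_apply]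
      conv_lhs => rw [pi_eq_sum_univ' (deriv (polyCurve x₀ (a x)) t)]
      simp [Finset.sum_apply, mul_comm]
    rw [hv, iteratedDeriv_fun_sum, Finset.sum_apply]
    exact fun i _ => (((hF i).comp (hγs x)).mul (hx' x i)).contDiffAt.of_le
      (by exact_mod_cast le_top)
  rw [hsum]
  refine A.sum_mem fun i _ => iteratedDeriv_mul_mem A (fun x => (hF i).comp (hγs x))
    (fun x => hx' x i) (fun k hk => ?_) (fun k hk => ?_)
  · refine iteratedDeriv_comp_mem A (x₀, y₀)
      (Sum.elim (fun i => (Pi.single i 1, 0)) (fun i => (0, Pi.single i 1)))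
      (fun x => Sum.elim (fun i t => polyCurve x₀ (a x) t i) (fun i t => polyCurve y₀ (b x) t i))
      γ (fun x t => ?_) (fun x => ?_) (fun x i => ?_) k (fun m hm i => ?_) (F i) (hF i)
    · ext i <;> simp [hγdef, Fintype.sum_sum_type, Prod.fst_sum, Prod.snd_sum, Finset.sum_apply,
        Pi.single_apply]
    · simp [hγdef, polyCurve_zero]
    · cases i with
      | inl i => exact contDiff_polyCurve_apply x₀ (a x) i
      | inr i => exact contDiff_polyCurve_apply y₀ (b x) i
    · cases i with
      | inl i =>
        exact iteratedDeriv_succ_polyCurve_apply_mem A x₀ a m i fun j hj => ha j i (by omega)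
      | inr i =>
        exact iteratedDeriv_succ_polyCurve_apply_mem A y₀ b m i fun j hj => hb j i (by omega)
  · simpa only [iteratedDeriv_succ'] using
      iteratedDeriv_succ_polyCurve_apply_mem A x₀ a k i fun j hj => ha j i (by omega)

theorem iteratedDeriv_liftVelocity_congr (hf : ContDiff ℝ ∞ f) (a : Fin r → (Fin l → ℝ))
    {b b' : Fin r → (Fin p → ℝ)} {n : ℕ} (h : ∀ j : Fin r, (j : ℕ) < n → b j = b' j)
    (c : Fin p) :
    iteratedDeriv n (fun t => liftVelocity f x₀ y₀ a b t c) 0 =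
      iteratedDeriv n (fun t => liftVelocity f x₀ y₀ a b' t c) 0 := by
  have hmem := iteratedDeriv_liftVelocity_mem (x₀ := x₀) (y₀ := y₀)
    (⊥ : Subalgebra ℝ (Bool → ℝ)) hf (fun _ => a) (fun s => bif s then b else b') n
    (fun j i _ => Subalgebra.algebraMap_mem _ (a j i))
    (fun j i hj => by
      have hconst : (fun s => (bif s then b else b') j i) = algebraMap ℝ (Bool → ℝ) (b j i) := by
        ext s
        cases s <;> simp [h j hj]
      rw [hconst]
      exact Subalgebra.algebraMap_mem _ _) c
  obtain ⟨y, hy⟩ := Algebra.mem_bot.mp hmem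
  exact (congrFun hy true).symm.trans (congrFun hy false)

theorem IsJetLift.unique (hf : ContDiff ℝ ∞ f) {a : Fin r → (Fin l → ℝ)}
    {b b' : Fin r → (Fin p → ℝ)} (hb : IsJetLift f x₀ y₀ r a b)
    (hb' : IsJetLift f x₀ y₀ r a b') : b = b' := by
  rw [isJetLift_iff hf] at hb hb'
  have h : ∀ (n : ℕ) (hn : n < r), b ⟨n, hn⟩ = b' ⟨n, hn⟩ := by
    intro n
    induction n using Nat.strong_induction_on with
    | _ n ih =>
      intro hn
      ext c
      refine mul_left_cancel₀ (Nat.cast_ne_zero.mpr (n + 1).factorial_ne_zero : ((n + 1)! : ℝ) ≠ 0)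
        ((hb ⟨n, hn⟩ c).trans (Eq.trans ?_ (hb' ⟨n, hn⟩ c).symm))
      exact iteratedDeriv_liftVelocity_congr hf a (fun j hj => ih j hj j.isLt) c
  exact funext fun j => h j j.isLt

theorem exists_isJetLift (hf : ContDiff ℝ ∞ f) (a : Fin r → (Fin l → ℝ)) :
    ∃ b : Fin r → (Fin p → ℝ), IsJetLift f x₀ y₀ r a b := by
  have h : ∀ m ≤ r, ∃ b : Fin r → (Fin p → ℝ), ∀ (j : Fin r) (c : Fin p), (j : ℕ) < m →
      (((j : ℕ) + 1)! : ℝ) * b j c =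
        iteratedDeriv j (fun t => liftVelocity f x₀ y₀ a b t c) 0 := by
    intro m
    induction m with
    | zero => exact fun _ => ⟨0, fun j c hj => absurd hj (Nat.not_lt_zero _)⟩
    | succ m ih =>
      intro hm
      obtain ⟨b, hb⟩ := ih (by omega)
      let b' := Function.update b ⟨m, hm⟩ fun c =>
        iteratedDeriv m (fun t => liftVelocity f x₀ y₀ a b t c) 0 / ((m + 1)! : ℝ)
      have hb' : ∀ j : Fin r, (j : ℕ) < m → b j = b' j := fun j hj =>
        (Function.update_of_ne (fun h => by simp [h] at hj) _ _).symm
      refine ⟨b', fun j c hj => ?_⟩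
      rw [← iteratedDeriv_liftVelocity_congr hf a (fun i hi => hb' i (by omega)) c]
      rcases Nat.lt_succ_iff_lt_or_eq.mp hj with hlt | heq
      · rw [← hb' j hlt]
        exact hb j c hlt
      · obtain rfl : j = ⟨m, hm⟩ := Fin.ext heq
        simp only [b', Function.update_self]
        exact mul_div_cancel₀ _ (Nat.cast_ne_zero.mpr (m + 1).factorial_ne_zero)
  obtain ⟨b, hb⟩ := h r le_rfl
  exact ⟨b, (isJetLift_iff hf a b).mpr fun j c => hb j c j.isLt⟩

/-- Evaluation of polynomials as functions of the tuple of coefficients. -/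
noncomputable def coeffEval (l r : ℕ) :
    MvPolynomial (Fin r × Fin l) ℝ →ₐ[ℝ] ((Fin r → (Fin l → ℝ)) → ℝ) :=
  MvPolynomial.aeval fun v a => a v.1 v.2

theorem coeffEval_apply (P : MvPolynomial (Fin r × Fin l) ℝ) (a : Fin r → (Fin l → ℝ)) :
    coeffEval l r P a = MvPolynomial.eval (fun v => a v.1 v.2) P := by
  have h : (Pi.evalAlgHom ℝ (fun _ : Fin r → (Fin l → ℝ) => ℝ) a).comp (coeffEval l r) =
      MvPolynomial.aeval fun v => a v.1 v.2 := by
    ext v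
    simp [coeffEval]
  simpa [MvPolynomial.aeval_eq_eval] using DFunLike.congr_fun h P

theorem jetLift_mem_map_coeffEval (hf : ContDiff ℝ ∞ f)
    (b : (Fin r → (Fin l → ℝ)) → Fin r → (Fin p → ℝ))
    (hb : ∀ a, IsJetLift f x₀ y₀ r a (b a)) (j : Fin r) (c : Fin p) :
    (fun a => b a j c) ∈
      (MvPolynomial.supported ℝ {v : Fin r × Fin l | (v.1 : ℕ) ≤ j}).map (coeffEval l r) := by
  obtain ⟨n, hn⟩ := j
  induction n using Nat.strong_induction_on generalizing c with
  | _ n ih =>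
    set A := (MvPolynomial.supported ℝ {v : Fin r × Fin l | (v.1 : ℕ) ≤ n}).map (coeffEval l r)
    have hmem := iteratedDeriv_liftVelocity_mem (x₀ := x₀) (y₀ := y₀) A hf (fun a => a) b n
      (fun i k hi => ⟨MvPolynomial.X (i, k), MvPolynomial.X_mem_supported.mpr hi, by
        simp [coeffEval]⟩)
      (fun i k hi => Subalgebra.map_mono
        (MvPolynomial.supported_mono fun v hv => le_trans hv hi.le) (ih i hi k i.isLt)) c
    have hsmul : (fun a => b a ⟨n, hn⟩ c) = ((n + 1)! : ℝ)⁻¹ • fun a =>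
        iteratedDeriv n (fun t => liftVelocity f x₀ y₀ a (b a) t c) 0 := by
      ext a
      have h := (isJetLift_iff hf a (b a)).mp (hb a) ⟨n, hn⟩ c
      rw [Pi.smul_apply, smul_eq_mul, eq_inv_mul_iff_mul_eq₀
        (Nat.cast_ne_zero.mpr (n + 1).factorial_ne_zero)]
      exact h
    rw [hsmul]
    exact A.smul_mem hmem _

end JetLift

/-- For `f : ℝ^l × ℝ^p → L(ℝ^l, ℝ^p)` smooth, every basepoint `(x₀, y₀)`, every `r ≥ 1` and every
tuple `a ∈ (ℝ^l)^r`, there is a unique tuple `b ∈ (ℝ^p)^r` such that the polynomial curve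
`(x₀ + ∑ aⱼ tʲ, y₀ + ∑ bⱼ tʲ)` is horizontal to order `r` at `t = 0`; moreover, for fixed
`(x₀, y₀)` the map `a ↦ b` is polynomial, each coordinate of `bⱼ` being given by a real
polynomial in the coordinates of `a₁, …, aⱼ`. -/
theorem jet_lift_exists_unique_polynomial
    (l p : ℕ) (hl : 1 ≤ l) (hp : 1 ≤ p)
    (f : (Fin l → ℝ) × (Fin p → ℝ) → ((Fin l → ℝ) →L[ℝ] (Fin p → ℝ)))
    (hf : ContDiff ℝ (⊤ : ℕ∞) f) :
    ∀ (x₀ : Fin l → ℝ) (y₀ : Fin p → ℝ) (r : ℕ), 1 ≤ r →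
      (∀ a : Fin r → (Fin l → ℝ),
        ∃! b : Fin r → (Fin p → ℝ), IsJetLift f x₀ y₀ r a b) ∧
      ∃ P : Fin r → Fin p → MvPolynomial (Fin r × Fin l) ℝ,
        (∀ j c, ∀ v ∈ (P j c).vars, (v.1 : ℕ) ≤ (j : ℕ)) ∧
        (∀ (a : Fin r → (Fin l → ℝ)) (b : Fin r → (Fin p → ℝ)),
          IsJetLift f x₀ y₀ r a b →
            ∀ j c, b j c = MvPolynomial.eval (fun v => a v.1 v.2) (P j c)) := by
  intro x₀ y₀ r _
  choose b hb using fun a => exists_isJetLift (x₀ := x₀) (y₀ := y₀) (r := r) hf a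
  refine ⟨fun a => ⟨b a, hb a, fun b' hb' => hb'.unique hf (hb a)⟩, ?_⟩
  choose P hP hPb using fun j c => jetLift_mem_map_coeffEval hf b hb j c
  refine ⟨P, fun j c v hv => MvPolynomial.mem_supported.mp (hP j c) hv, fun a b' hb' j c => ?_⟩
  rw [hb'.unique hf (hb a), ← coeffEval_apply]
  exact (congrFun (hPb j c) a).symm
end

section
/- Suppose f : ℝ^l × ℝ^p → L(ℝ^l, ℝ^p) is smooth (C^∞). Let r ≥ 1, ε > 0, and let x_1, x_2 : (−ε, ε) → ℝ^l be C^r curves whose derivatives at 0 agree up to order r (x_1^{(j)}(0) = x_2^{(j)}(0) for all 0 ≤ j ≤ r). Let y_1, y_2 : (−ε, ε) → ℝ^p be differentiable curves with y_i′(t) = f(x_i(t), y_i(t))(x_i′(t)) for all t ∈ (−ε, ε) and with y_1(0) = y_2(0). Then y_1 and y_2 are C^r and their derivatives at 0 agree up to order r: y_1^{(j)}(0) = y_2^{(j)}(0) for all 0 ≤ j ≤ r. -/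
section Jets

variable {E F : Type*} [NormedAddCommGroup E] [NormedSpace ℝ E]
  [NormedAddCommGroup F] [NormedSpace ℝ F]

/-- Two curves have the same iterated derivative at a point iff they have the same iterated
Fréchet derivative there. -/
theorem iteratedDerivWithin_eq_iff_iteratedFDerivWithin_eq {u v : ℝ → E} {s : Set ℝ} {t : ℝ}
    {n : ℕ} :
    iteratedDerivWithin n u s t = iteratedDerivWithin n v s t ↔
      iteratedFDerivWithin ℝ n u s t = iteratedFDerivWithin ℝ n v s t := by
  refine ⟨fun h ↦ ?_, fun h ↦ by simp only [iteratedDerivWithin, h]⟩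
  ext
  simp only [iteratedFDerivWithin_apply_eq_iteratedDerivWithin_mul_prod, h]

/-- The `n`-jet of `t ↦ (u t, v t)` is determined by the `n`-jets of `u` and `v`. -/
theorem iteratedDerivWithin_prodMk_congr {u₁ u₂ : ℝ → E} {v₁ v₂ : ℝ → F} {s : Set ℝ} {t : ℝ}
    {n : ℕ} (hs : UniqueDiffOn ℝ s) (ht : t ∈ s)
    (hu₁ : ContDiffOn ℝ n u₁ s) (hu₂ : ContDiffOn ℝ n u₂ s)
    (hv₁ : ContDiffOn ℝ n v₁ s) (hv₂ : ContDiffOn ℝ n v₂ s)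
    (hu : ∀ j ≤ n, iteratedDerivWithin j u₁ s t = iteratedDerivWithin j u₂ s t)
    (hv : ∀ j ≤ n, iteratedDerivWithin j v₁ s t = iteratedDerivWithin j v₂ s t) :
    ∀ j ≤ n, iteratedDerivWithin j (fun a ↦ (u₁ a, v₁ a)) s t =
      iteratedDerivWithin j (fun a ↦ (u₂ a, v₂ a)) s t := by
  intro j hj
  have hj' : (j : WithTop ℕ∞) ≤ n := by exact_mod_cast hj
  rw [iteratedDerivWithin_eq_iff_iteratedFDerivWithin_eq,
    iteratedFDerivWithin_prodMk (hu₁ t ht) (hv₁ t ht) hs ht hj',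
    iteratedFDerivWithin_prodMk (hu₂ t ht) (hv₂ t ht) hs ht hj',
    iteratedDerivWithin_eq_iff_iteratedFDerivWithin_eq.1 (hu j hj),
    iteratedDerivWithin_eq_iff_iteratedFDerivWithin_eq.1 (hv j hj)]

/-- The `n`-jet of `g ∘ u` is determined by the `n`-jet of `u`. -/
theorem iteratedDerivWithin_comp_congr {g : E → F} {u v : ℝ → E} {s : Set ℝ} {t : ℝ} {n : ℕ}
    (hg : ContDiff ℝ n g) (hs : UniqueDiffOn ℝ s) (ht : t ∈ s)
    (hu : ContDiffOn ℝ n u s) (hv : ContDiffOn ℝ n v s)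
    (huv : ∀ j ≤ n, iteratedDerivWithin j u s t = iteratedDerivWithin j v s t) :
    ∀ j ≤ n, iteratedDerivWithin j (g ∘ u) s t = iteratedDerivWithin j (g ∘ v) s t := by
  intro j hj
  have hj' : (j : WithTop ℕ∞) ≤ n := by exact_mod_cast hj
  have h₀ : u t = v t := by simpa using huv 0 n.zero_le
  rw [iteratedDerivWithin_eq_iff_iteratedFDerivWithin_eq,
    iteratedFDerivWithin_comp hg.contDiffAt.contDiffWithinAt (hu t ht) uniqueDiffOn_univ hs ht
      (Set.mapsTo_univ _ _) hj',
    iteratedFDerivWithin_comp hg.contDiffAt.contDiffWithinAt (hv t ht) uniqueDiffOn_univ hs ht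
      (Set.mapsTo_univ _ _) hj', h₀]
  unfold FormalMultilinearSeries.taylorComp
  refine Finset.sum_congr rfl fun c _ ↦ ?_
  unfold FormalMultilinearSeries.compAlongOrderedFinpartition
  congr 1
  funext m
  exact iteratedDerivWithin_eq_iff_iteratedFDerivWithin_eq.1
    (huv _ ((c.partSize_le m).trans hj))

/-- A horizontal lift of a `C^n` curve is `C^n`. -/
theorem contDiffOn_of_hasDerivAt_lift {f : E × F → E →L[ℝ] F} {x : ℝ → E} {y : ℝ → F}
    {s : Set ℝ} {r : ℕ} (hf : ContDiff ℝ r f) (hs : IsOpen s) (hx : ContDiffOn ℝ r x s)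
    (hy : ∀ t ∈ s, HasDerivAt y (f (x t, y t) (deriv x t)) t) :
    ContDiffOn ℝ r y s := by
  have hdiff : DifferentiableOn ℝ y s := fun t ht ↦
    (hy t ht).differentiableAt.differentiableWithinAt
  suffices H : ∀ k ≤ r, ContDiffOn ℝ k y s from H r le_rfl
  intro k
  induction k with
  | zero => exact fun _ ↦ contDiffOn_zero.2 hdiff.continuousOn
  | succ k ih =>
    intro hk
    have hkr : (k : WithTop ℕ∞) ≤ r := by exact_mod_cast (Nat.le_succ k).trans hk
    have hx' : ContDiffOn ℝ k (deriv x) s :=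
      hx.deriv_of_isOpen hs (by exact_mod_cast hk)
    rw [Nat.cast_succ, contDiffOn_succ_iff_deriv_of_isOpen hs]
    refine ⟨hdiff, by simp, ContDiffOn.congr ?_ fun t ht ↦ (hy t ht).deriv⟩
    exact ((hf.of_le hkr).comp_contDiffOn
      ((hx.of_le hkr).prodMk (ih ((Nat.le_succ k).trans hk)))).clm_apply hx'

/-- The `r`-jet of a horizontal lift is determined by its initial point and the `r`-jet of the
projected curve. -/
theorem iteratedDerivWithin_lift_congr {f : E × F → E →L[ℝ] F} {x₁ x₂ : ℝ → E} {y₁ y₂ : ℝ → F}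
    {s : Set ℝ} {t₀ : ℝ} {r : ℕ} (hf : ContDiff ℝ r f) (hs : IsOpen s) (ht₀ : t₀ ∈ s)
    (hx₁ : ContDiffOn ℝ r x₁ s) (hx₂ : ContDiffOn ℝ r x₂ s)
    (hx : ∀ j ≤ r, iteratedDerivWithin j x₁ s t₀ = iteratedDerivWithin j x₂ s t₀)
    (hy₁ : ∀ t ∈ s, HasDerivAt y₁ (f (x₁ t, y₁ t) (deriv x₁ t)) t)
    (hy₂ : ∀ t ∈ s, HasDerivAt y₂ (f (x₂ t, y₂ t) (deriv x₂ t)) t)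
    (h₀ : y₁ t₀ = y₂ t₀) :
    ∀ j ≤ r, iteratedDerivWithin j y₁ s t₀ = iteratedDerivWithin j y₂ s t₀ := by
  suffices H : ∀ k ≤ r, ∀ j ≤ k,
      iteratedDerivWithin j y₁ s t₀ = iteratedDerivWithin j y₂ s t₀ from H r le_rfl
  intro k
  induction k with
  | zero =>
    intro _ j hj
    obtain rfl := Nat.le_zero.1 hj
    simpa using h₀
  | succ k ih =>
    intro hk j hj
    rcases j with _ | j
    · simpa using h₀
    have hk' : k ≤ r := (Nat.le_succ k).trans hk
    have hkr : (k : WithTop ℕ∞) ≤ r := by exact_mod_cast hk'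
    have hkr' : (k + 1 : WithTop ℕ∞) ≤ r := by exact_mod_cast hk
    have hsu := hs.uniqueDiffOn (𝕜 := ℝ)
    have hY₁ := (contDiffOn_of_hasDerivAt_lift hf hs hx₁ hy₁).of_le hkr
    have hY₂ := (contDiffOn_of_hasDerivAt_lift hf hs hx₂ hy₂).of_le hkr
    have hX₁ := hx₁.of_le hkr
    have hX₂ := hx₂.of_le hkr
    have hD₁ := hx₁.derivWithin hsu hkr'
    have hD₂ := hx₂.derivWithin hsu hkr'
    have hg : ContDiff ℝ k (fun q : (E × F) × E ↦ f q.1 q.2) :=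
      ((hf.of_le hkr).comp contDiff_fst).clm_apply contDiff_snd
    have hxy := iteratedDerivWithin_prodMk_congr hsu ht₀ hX₁ hX₂ hY₁ hY₂
      (fun i hi ↦ hx i (hi.trans hk')) (ih hk')
    have hD : ∀ i ≤ k, iteratedDerivWithin i (derivWithin x₁ s) s t₀ =
        iteratedDerivWithin i (derivWithin x₂ s) s t₀ := fun i hi ↦ by
      simpa only [iteratedDerivWithin_succ'] using hx (i + 1) (by lia)
    have key := iteratedDerivWithin_comp_congr hg hsu ht₀ ((hX₁.prodMk hY₁).prodMk hD₁)
      ((hX₂.prodMk hY₂).prodMk hD₂)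
      (iteratedDerivWithin_prodMk_congr hsu ht₀ (hX₁.prodMk hY₁) (hX₂.prodMk hY₂) hD₁ hD₂ hxy hD)
      j (Nat.le_of_succ_le_succ hj)
    have hE : ∀ {x : ℝ → E} {y : ℝ → F},
        (∀ t ∈ s, HasDerivAt y (f (x t, y t) (deriv x t)) t) →
        Set.EqOn (derivWithin y s)
          ((fun q : (E × F) × E ↦ f q.1 q.2) ∘ fun t ↦ ((x t, y t), derivWithin x s t)) s := by
      intro x y hy t ht
      simp only [Function.comp_apply, derivWithin_of_isOpen hs ht, (hy t ht).deriv]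
    rw [iteratedDerivWithin_succ', iteratedDerivWithin_succ',
      iteratedDerivWithin_congr (hE hy₁) ht₀, iteratedDerivWithin_congr (hE hy₂) ht₀, key]

end Jets

/-- Let `f : ℝ^l × ℝ^p → L(ℝ^l, ℝ^p)` be smooth.  Let `r ≥ 1`, `ε > 0`, and let
`x₁, x₂ : (−ε, ε) → ℝ^l` be `Cʳ` curves whose derivatives at `0` agree up to order `r`.
Let `y₁, y₂ : (−ε, ε) → ℝ^p` be differentiable with `yᵢ′ t = f (xᵢ t, yᵢ t) (xᵢ′ t)` on
`(−ε, ε)` and `y₁ 0 = y₂ 0`.  Then `y₁, y₂` are `Cʳ` and their derivatives at `0` agree up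
to order `r`. -/
theorem horizontal_lift_jet_determinacy
    (l p : ℕ) (hl : 1 ≤ l) (hp : 1 ≤ p)
    (f : (Fin l → ℝ) × (Fin p → ℝ) → ((Fin l → ℝ) →L[ℝ] (Fin p → ℝ)))
    (hf : ContDiff ℝ (⊤ : ℕ∞) f)
    (r : ℕ) (hr : 1 ≤ r) (ε : ℝ) (hε : 0 < ε)
    (x₁ x₂ : ℝ → (Fin l → ℝ))
    (hx₁ : ContDiffOn ℝ r x₁ (Set.Ioo (-ε) ε))
    (hx₂ : ContDiffOn ℝ r x₂ (Set.Ioo (-ε) ε))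
    (hagree : ∀ j ≤ r,
      iteratedDerivWithin j x₁ (Set.Ioo (-ε) ε) 0
        = iteratedDerivWithin j x₂ (Set.Ioo (-ε) ε) 0)
    (y₁ y₂ : ℝ → (Fin p → ℝ))
    (hy₁ : ∀ t ∈ Set.Ioo (-ε) ε, HasDerivAt y₁ (f (x₁ t, y₁ t) (deriv x₁ t)) t)
    (hy₂ : ∀ t ∈ Set.Ioo (-ε) ε, HasDerivAt y₂ (f (x₂ t, y₂ t) (deriv x₂ t)) t)
    (h0 : y₁ 0 = y₂ 0) :
    ContDiffOn ℝ r y₁ (Set.Ioo (-ε) ε) ∧ ContDiffOn ℝ r y₂ (Set.Ioo (-ε) ε) ∧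
    ∀ j ≤ r,
      iteratedDerivWithin j y₁ (Set.Ioo (-ε) ε) 0
        = iteratedDerivWithin j y₂ (Set.Ioo (-ε) ε) 0 := by
  have hfr : ContDiff ℝ r f := hf.of_le (by exact_mod_cast le_top)
  have h0mem : (0 : ℝ) ∈ Set.Ioo (-ε) ε := ⟨neg_lt_zero.2 hε, hε⟩
  exact ⟨contDiffOn_of_hasDerivAt_lift hfr isOpen_Ioo hx₁ hy₁,
    contDiffOn_of_hasDerivAt_lift hfr isOpen_Ioo hx₂ hy₂,
    iteratedDerivWithin_lift_congr hfr isOpen_Ioo h0mem hx₁ hx₂ hagree hy₁ hy₂ h0⟩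
end

section
/- Let f : ℝ^l × ℝ^p → L(ℝ^l, ℝ^p) be smooth, let x : [0,1] → ℝ^l be C¹, and suppose y : [0,1] → ℝ^p is a C¹ solution of y′(t) = f(x(t), y(t))(x′(t)) on [0,1]. Then there exists ε > 0 such that for every C¹ curve x̃ : [0,1] → ℝ^l with sup_{t∈[0,1]} ( |x̃(t) − x(t)| + |x̃′(t) − x′(t)| ) < ε and every ỹ₀ ∈ ℝ^p with |ỹ₀ − y(0)| < ε, there exists a unique C¹ map ỹ : [0,1] → ℝ^p with ỹ(0) = ỹ₀ and ỹ′(t) = f(x̃(t), ỹ(t))(x̃′(t)) for all t ∈ [0,1]. -/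
open Set Metric
open scoped NNReal ContDiff

section LiftingODE

variable {E F : Type*} [NormedAddCommGroup E] [NormedSpace ℝ E]
  [NormedAddCommGroup F] [NormedSpace ℝ F]

/-- The Grönwall bound is homogeneous in the initial error and the defect. -/
theorem gronwallBound_mul_left (c δ K η t : ℝ) :
    gronwallBound (c * δ) K (c * η) t = c * gronwallBound δ K η t := by
  unfold gronwallBound
  split_ifs <;> ring

/-- A solution of a lifting ODE along a `C¹` curve is itself `C¹`. -/
theorem contDiffOn_one_of_lifting {g : E × F → E →L[ℝ] F} (hg : Continuous g)
    {u : ℝ → E} (hu : ContDiffOn ℝ 1 u (Icc 0 1)) {z : ℝ → F}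
    (hz : ∀ t ∈ Icc (0 : ℝ) 1,
      HasDerivWithinAt z (g (u t, z t) (derivWithin u (Icc 0 1) t)) (Icc 0 1) t) :
    ContDiffOn ℝ 1 z (Icc 0 1) := by
  have hI : UniqueDiffOn ℝ (Icc (0 : ℝ) 1) := uniqueDiffOn_Icc one_pos
  refine (contDiffOn_one_iff_derivWithin hI).2
    ⟨fun t ht => (hz t ht).differentiableWithinAt, ?_⟩
  have hzc : ContinuousOn z (Icc 0 1) := HasDerivWithinAt.continuousOn hz
  exact ((hg.comp_continuousOn (hu.continuousOn.prodMk hzc)).clm_apply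
    (hu.continuousOn_derivWithin hI le_rfl)).congr
      fun t ht => (hz t ht).derivWithin (hI t ht)

/-- The vector field `z ↦ g (a, z) b` inherits a Lipschitz bound from `g`. -/
theorem LipschitzOnWith.clm_apply_prodMk {g : E × F → E →L[ℝ] F} {K : ℝ≥0} {s : Set (E × F)}
    (hg : LipschitzOnWith K g s) {S : Set F} {a b : E} {M : ℝ≥0} (hb : ‖b‖ ≤ M)
    (hS : ∀ z ∈ S, (a, z) ∈ s) :
    LipschitzOnWith (K * M) (fun z => g (a, z) b) S := by
  refine LipschitzOnWith.of_dist_le_mul fun z hz w hw => ?_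
  have h := hg.dist_le_mul _ (hS z hz) _ (hS w hw)
  rw [Prod.dist_eq, dist_self, max_eq_right dist_nonneg, dist_eq_norm] at h
  rw [dist_eq_norm, ← sub_apply]
  calc ‖(g (a, z) - g (a, w)) b‖ ≤ ‖g (a, z) - g (a, w)‖ * ‖b‖ :=
        ContinuousLinearMap.le_opNorm _ _
    _ ≤ (K * dist z w) * M := by gcongr
    _ = (K * M : ℝ≥0) * dist z w := by push_cast; ring

/-- A bounded, globally Lipschitz lifting ODE has a solution on the whole unit interval. -/
theorem exists_lifting_of_lipschitzWith [CompleteSpace F] {g : E × F → E →L[ℝ] F}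
    {K B M : ℝ≥0} (hg : LipschitzWith K g) (hB : ∀ q, ‖g q‖ ≤ B)
    {u : ℝ → E} (hu : ContDiffOn ℝ 1 u (Icc 0 1))
    (hM : ∀ t ∈ Icc (0 : ℝ) 1, ‖derivWithin u (Icc 0 1) t‖ ≤ M) (z₀ : F) :
    ∃ z : ℝ → F, z 0 = z₀ ∧ ∀ t ∈ Icc (0 : ℝ) 1,
      HasDerivWithinAt z (g (u t, z t) (derivWithin u (Icc 0 1) t)) (Icc 0 1) t := by
  have hI : UniqueDiffOn ℝ (Icc (0 : ℝ) 1) := uniqueDiffOn_Icc one_pos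
  have hPL : IsPicardLindelof (fun t z => g (u t, z) (derivWithin u (Icc 0 1) t))
      (⟨0, by simp⟩ : Icc (0 : ℝ) 1) z₀ (B * M) 0 (B * M) (K * M) :=
    { lipschitzOnWith := fun t ht =>
        (hg.lipschitzOnWith (s := univ)).clm_apply_prodMk (hM t ht) fun _ _ => mem_univ _
      continuousOn := fun z _ =>
        (hg.continuous.comp_continuousOn (hu.continuousOn.prodMk continuousOn_const)).clm_apply
          (hu.continuousOn_derivWithin hI le_rfl)
      norm_le := fun t ht z _ => by
        push_cast
        exact (ContinuousLinearMap.le_opNorm _ _).trans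
          (mul_le_mul (hB _) (hM t ht) (norm_nonneg _) B.2)
      mul_max_le := by simp }
  exact hPL.exists_eq_forall_mem_Icc_hasDerivWithinAt₀

/-- Solutions of a bounded, globally Lipschitz lifting ODE depend continuously, in a quantitative
way, on the base curve and on the initial value. -/
theorem dist_lifting_le {g : E × F → E →L[ℝ] F} {K B M : ℝ≥0} (hg : LipschitzWith K g)
    (hB : ∀ q, ‖g q‖ ≤ B) {u v du dv : ℝ → E} {y z : ℝ → F} {ε : ℝ}
    (hu : ∀ t ∈ Icc (0 : ℝ) 1, ‖du t‖ ≤ M) (hv : ∀ t ∈ Icc (0 : ℝ) 1, ‖dv t‖ ≤ M)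
    (huv : ∀ t ∈ Icc (0 : ℝ) 1, ‖v t - u t‖ + ‖dv t - du t‖ ≤ ε)
    (hy : ∀ t ∈ Icc (0 : ℝ) 1, HasDerivWithinAt y (g (u t, y t) (du t)) (Icc 0 1) t)
    (hz : ∀ t ∈ Icc (0 : ℝ) 1, HasDerivWithinAt z (g (v t, z t) (dv t)) (Icc 0 1) t)
    (h0 : dist (y 0) (z 0) ≤ ε) :
    ∀ t ∈ Icc (0 : ℝ) 1, dist (y t) (z t) ≤ ε * gronwallBound 1 (K * M) (K * M + B) 1 := by
  intro t ht
  have hε : 0 ≤ ε := dist_nonneg.trans h0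
  have hder {w : ℝ → F} {w' : F} {s : ℝ} (hs : s ∈ Ico (0 : ℝ) 1)
      (h : HasDerivWithinAt w w' (Icc 0 1) s) : HasDerivWithinAt w w' (Ici s) s :=
    h.mono_of_mem_nhdsWithin <|
      Filter.mem_of_superset (Icc_mem_nhdsGE hs.2) (Icc_subset_Icc_left hs.1)
  have key := dist_le_of_approx_trajectories_ODE_of_mem
    (v := fun s q => g (v s, q) (dv s)) (s := fun _ => univ) (K := K * M)
    (εf := ε * (K * M + B)) (εg := 0) (a := 0) (b := 1)
    (fun s hs => (hg.lipschitzOnWith (s := univ)).clm_apply_prodMk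
      (hv s (Ico_subset_Icc_self hs)) fun _ _ => mem_univ _)
    (HasDerivWithinAt.continuousOn hy)
    (fun s hs => hder hs (hy s (Ico_subset_Icc_self hs)))
    (fun s hs => ?_) (fun _ _ => mem_univ _)
    (HasDerivWithinAt.continuousOn hz)
    (fun s hs => hder hs (hz s (Ico_subset_Icc_self hs)))
    (fun s _ => by simp) (fun _ _ => mem_univ _) h0 t ht
  · refine key.trans ?_
    rw [← gronwallBound_mul_left, mul_one, add_zero, NNReal.coe_mul]
    exact gronwallBound_mono hε (by positivity) (by positivity) (by linarith [ht.2])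
  · replace hs := Ico_subset_Icc_self hs
    have hd := huv s hs
    have hbase : ‖u s - v s‖ ≤ ε := by
      rw [norm_sub_rev]; linarith [norm_nonneg (dv s - du s)]
    have hvel : ‖du s - dv s‖ ≤ ε := by
      rw [norm_sub_rev]; linarith [norm_nonneg (v s - u s)]
    have hL : ‖g (u s, y s) - g (v s, y s)‖ ≤ K * ε := by
      have h := hg.dist_le_mul (u s, y s) (v s, y s)
      rw [Prod.dist_eq, dist_self, max_eq_left dist_nonneg, dist_eq_norm, dist_eq_norm] at h
      exact h.trans (by gcongr)
    calc dist (g (u s, y s) (du s)) (g (v s, y s) (dv s))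
        = ‖(g (u s, y s) - g (v s, y s)) (du s) + g (v s, y s) (du s - dv s)‖ := by
          rw [dist_eq_norm]; congr 1; simp
      _ ≤ ‖g (u s, y s) - g (v s, y s)‖ * ‖du s‖ + ‖g (v s, y s)‖ * ‖du s - dv s‖ :=
          (norm_add_le _ _).trans (add_le_add (ContinuousLinearMap.le_opNorm _ _)
            (ContinuousLinearMap.le_opNorm _ _))
      _ ≤ (K * ε) * M + B * ε := by
          gcongr
          exacts [hu s hs, hB _]
      _ = ε * (K * M + B) := by ring

/-- A `C¹` map on a finite-dimensional space agrees on any ball around the origin with a bounded,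
globally Lipschitz map. -/
theorem ContDiff.exists_lipschitzWith_bounded_eqOn_closedBall {V W : Type*}
    [NormedAddCommGroup V] [NormedSpace ℝ V] [FiniteDimensional ℝ V]
    [NormedAddCommGroup W] [NormedSpace ℝ W] {f : V → W} (hf : ContDiff ℝ 1 f) (R : ℝ) :
    ∃ (g : V → W) (K B : ℝ≥0), LipschitzWith K g ∧ (∀ q, ‖g q‖ ≤ B) ∧
      EqOn g f (closedBall 0 R) := by
  let χ : ContDiffBump (0 : V) := ⟨max R 1, max R 1 + 1, by positivity, by linarith⟩
  have hsupp : HasCompactSupport fun q => χ q • f q := χ.hasCompactSupport.smul_right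
  have hsmooth : ContDiff ℝ 1 fun q => χ q • f q := χ.contDiff.smul hf
  obtain ⟨K, hK⟩ := hsmooth.lipschitzWith_of_hasCompactSupport hsupp one_ne_zero
  obtain ⟨B, hB⟩ := hsupp.exists_bound_of_continuous hsmooth.continuous
  refine ⟨_, K, B.toNNReal, hK, fun q => (hB q).trans (Real.le_coe_toNNReal B), fun q hq => ?_⟩
  have hχ : χ q = 1 :=
    χ.one_of_mem_closedBall (closedBall_subset_closedBall (le_max_left R 1) hq)
  simp [hχ]

/-- Lifts of a `C¹` curve through a `C¹` distribution are determined by their initial value. -/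
theorem lifting_unique [FiniteDimensional ℝ E] [FiniteDimensional ℝ F]
    {f : E × F → E →L[ℝ] F} (hf : ContDiff ℝ 1 f)
    {u : ℝ → E} (hu : ContDiffOn ℝ 1 u (Icc 0 1)) {y z : ℝ → F}
    (hy : ∀ t ∈ Icc (0 : ℝ) 1,
      HasDerivWithinAt y (f (u t, y t) (derivWithin u (Icc 0 1) t)) (Icc 0 1) t)
    (hz : ∀ t ∈ Icc (0 : ℝ) 1,
      HasDerivWithinAt z (f (u t, z t) (derivWithin u (Icc 0 1) t)) (Icc 0 1) t)
    (h0 : y 0 = z 0) : EqOn y z (Icc 0 1) := by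
  have hyc : ContinuousOn y (Icc 0 1) := HasDerivWithinAt.continuousOn hy
  have hzc : ContinuousOn z (Icc 0 1) := HasDerivWithinAt.continuousOn hz
  obtain ⟨R, hR⟩ := isCompact_Icc.exists_bound_of_continuousOn
    ((hu.continuousOn.prodMk hyc).prodMk hzc)
  obtain ⟨M, hM⟩ := isCompact_Icc.exists_bound_of_continuousOn
    (hu.continuousOn_derivWithin (uniqueDiffOn_Icc one_pos) le_rfl)
  obtain ⟨g, K, B, hK, hB, hgf⟩ := hf.exists_lipschitzWith_bounded_eqOn_closedBall R
  have hbd (t : ℝ) (ht : t ∈ Icc (0 : ℝ) 1) : (‖u t‖ ≤ R ∧ ‖y t‖ ≤ R) ∧ ‖z t‖ ≤ R := by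
    simpa [Prod.norm_def] using hR t ht
  have hM' (t : ℝ) (ht : t ∈ Icc (0 : ℝ) 1) :
      ‖derivWithin u (Icc 0 1) t‖ ≤ M.toNNReal := (hM t ht).trans (Real.le_coe_toNNReal M)
  intro t ht
  have := dist_lifting_le hK hB (u := u) (v := u) (ε := 0) hM' hM' (by simp) (y := y) (z := z)
    (fun s hs => by
      rw [hgf (by simpa [Prod.norm_def] using (hbd s hs).1)]
      exact hy s hs)
    (fun s hs => by
      rw [hgf (by simpa [Prod.norm_def] using ⟨(hbd s hs).1.1, (hbd s hs).2⟩)]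
      exact hz s hs)
    (by simp [h0]) t ht
  simpa using this

end LiftingODE

/-- Let `f : ℝ^l × ℝ^p → L(ℝ^l, ℝ^p)` be smooth, `x : [0,1] → ℝ^l` a `C¹` curve, and
`y : [0,1] → ℝ^p` a `C¹` solution of the lifting ODE `y′ t = f (x t, y t) (x′ t)` on `[0,1]`.
Then there is `ε > 0` such that for every `C¹` curve `x' : [0,1] → ℝ^l` with
`sup_t (‖x' t − x t‖ + ‖x'′ t − x′ t‖) < ε` and every `z₀` with `‖z₀ − y 0‖ < ε`, there is a
unique `C¹` map `y' : [0,1] → ℝ^p` with `y' 0 = z₀` and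
`y'′ t = f (x' t, y' t) (x'′ t)` for all `t ∈ [0,1]`. -/
theorem horizontal_lift_stability
    (l p : ℕ) (hl : 1 ≤ l) (hp : 1 ≤ p)
    (f : (Fin l → ℝ) × (Fin p → ℝ) → ((Fin l → ℝ) →L[ℝ] (Fin p → ℝ)))
    (hf : ContDiff ℝ (⊤ : ℕ∞) f)
    (x : ℝ → (Fin l → ℝ)) (hx : ContDiffOn ℝ 1 x (Set.Icc 0 1))
    (y : ℝ → (Fin p → ℝ)) (hyC : ContDiffOn ℝ 1 y (Set.Icc 0 1))
    (hy : ∀ t ∈ Set.Icc (0 : ℝ) 1,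
      HasDerivWithinAt y (f (x t, y t) (derivWithin x (Set.Icc 0 1) t)) (Set.Icc 0 1) t) :
    ∃ ε > 0, ∀ xp : ℝ → (Fin l → ℝ), ContDiffOn ℝ 1 xp (Set.Icc 0 1) →
      (∀ t ∈ Set.Icc (0 : ℝ) 1,
        ‖xp t - x t‖ + ‖derivWithin xp (Set.Icc 0 1) t - derivWithin x (Set.Icc 0 1) t‖ < ε) →
      ∀ z₀ : Fin p → ℝ, ‖z₀ - y 0‖ < ε →
        ∃ yp : ℝ → (Fin p → ℝ),
          (ContDiffOn ℝ 1 yp (Set.Icc 0 1) ∧ yp 0 = z₀ ∧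
            ∀ t ∈ Set.Icc (0 : ℝ) 1,
              HasDerivWithinAt yp (f (xp t, yp t) (derivWithin xp (Set.Icc 0 1) t))
                (Set.Icc 0 1) t) ∧
          ∀ yq : ℝ → (Fin p → ℝ),
            (ContDiffOn ℝ 1 yq (Set.Icc 0 1) ∧ yq 0 = z₀ ∧
              ∀ t ∈ Set.Icc (0 : ℝ) 1,
                HasDerivWithinAt yq (f (xp t, yq t) (derivWithin xp (Set.Icc 0 1) t))
                  (Set.Icc 0 1) t) →
            ∀ t ∈ Set.Icc (0 : ℝ) 1, yq t = yp t := by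
  have hf1 : ContDiff ℝ 1 f := hf.of_le (by exact_mod_cast le_top)
  obtain ⟨R, hR⟩ := isCompact_Icc.exists_bound_of_continuousOn
    (hx.continuousOn.prodMk hyC.continuousOn)
  obtain ⟨M, hM⟩ := isCompact_Icc.exists_bound_of_continuousOn
    (hx.continuousOn_derivWithin (uniqueDiffOn_Icc one_pos) le_rfl)
  obtain ⟨g, K, B, hK, hB, hgf⟩ := hf1.exists_lipschitzWith_bounded_eqOn_closedBall (R + 1)
  have hMx (t : ℝ) (ht : t ∈ Icc (0 : ℝ) 1) :
      ‖derivWithin x (Icc 0 1) t‖ ≤ (M.toNNReal + 1 : ℝ≥0) := by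
    push_cast
    linarith [hM t ht, Real.le_coe_toNNReal M]
  set C : ℝ := gronwallBound 1 (K * (M.toNNReal + 1 : ℝ≥0)) (K * (M.toNNReal + 1 : ℝ≥0) + B) 1
    with hC
  have hC1 : 1 ≤ C := by
    simpa only [gronwallBound_x0] using gronwallBound_mono (δ := 1)
      (K := K * (M.toNNReal + 1 : ℝ≥0)) (ε := K * (M.toNNReal + 1 : ℝ≥0) + B)
      zero_le_one (by positivity) (by positivity) (zero_le_one (α := ℝ))
  have hC0 : 0 < C := one_pos.trans_le hC1
  refine ⟨C⁻¹, inv_pos.2 hC0, fun xp hxp hclose z₀ hz₀ => ?_⟩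
  have hε1 : C⁻¹ ≤ 1 := inv_le_one_of_one_le₀ hC1
  have hMxp (t : ℝ) (ht : t ∈ Icc (0 : ℝ) 1) :
      ‖derivWithin xp (Icc 0 1) t‖ ≤ (M.toNNReal + 1 : ℝ≥0) := by
    push_cast
    linarith [hM t ht, Real.le_coe_toNNReal M, hclose t ht, norm_nonneg (xp t - x t),
      norm_le_norm_add_norm_sub' (derivWithin xp (Icc 0 1) t) (derivWithin x (Icc 0 1) t)]
  obtain ⟨yp, hyp0, hyp⟩ := exists_lifting_of_lipschitzWith hK hB hxp hMxp z₀
  have hbd (t : ℝ) (ht : t ∈ Icc (0 : ℝ) 1) : ‖x t‖ ≤ R ∧ ‖y t‖ ≤ R := by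
    simpa [Prod.norm_def] using hR t ht
  have hdist := dist_lifting_le hK hB hMx hMxp (fun t ht => (hclose t ht).le) (y := y)
    (fun t ht => by
      rw [hgf (mem_closedBall_zero_iff.2 (by linarith [hR t ht]))]
      exact hy t ht)
    hyp (by rw [hyp0, dist_eq_norm, norm_sub_rev]; exact hz₀.le)
  rw [← hC, inv_mul_cancel₀ hC0.ne'] at hdist
  have hypf (t : ℝ) (ht : t ∈ Icc (0 : ℝ) 1) :
      HasDerivWithinAt yp (f (xp t, yp t) (derivWithin xp (Icc 0 1) t)) (Icc 0 1) t := by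
    have hxt : ‖xp t‖ ≤ R + 1 := by
      linarith [(hbd t ht).1, hclose t ht, norm_le_norm_add_norm_sub' (xp t) (x t),
        norm_nonneg (derivWithin xp (Icc 0 1) t - derivWithin x (Icc 0 1) t)]
    have hyt : ‖yp t‖ ≤ R + 1 := by
      have h := hdist t ht
      rw [dist_eq_norm] at h
      linarith [(hbd t ht).2, norm_le_norm_add_norm_sub (y t) (yp t)]
    rw [← hgf (by simpa [Prod.norm_def] using ⟨hxt, hyt⟩)]
    exact hyp t ht
  exact ⟨yp, ⟨contDiffOn_one_of_lifting hf.continuous hxp hypf, hyp0, hypf⟩,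
    fun yq hyq => lifting_unique hf1 hxp hyq.2.2 hypf (hyq.2.1.trans hyp0.symm)⟩
end
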